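/- arXiv:2405.09732 — 9 statements merged into one kernel-verified Lean document; each statement's English description precedes it below -/
import Mathlib

section
/- Let α, k₁, H, D be real numbers with α ≠ 0. If 2H²(4αk₁(D + H²) + 1) + D = 0, 4αH²(4D + 5H²) = 0, and 4αk₁H⁴ + H² = 0 all hold, then H = 0. (Hence, for the linear coupling f(φ) = −αφ, the constraint χ = 0 forces the Hubble function to vanish and the model is trivial.) -/
/-- For the linear coupling `f(φ) = -α·φ` (with `α ≠ 0`), when `χ = 0` the scalar
field is a constant `k₁` and, writing `D` for `Ḣ`, the field equations reduce to the
three algebraic relations below; these force the Hubble function to vanish: `H = 0`. -/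
theorem linear_coupling_chi_zero_trivial (α k₁ H D : ℝ) (hα : α ≠ 0)
    (h1 : 2 * H ^ 2 * (4 * α * k₁ * (D + H ^ 2) + 1) + D = 0)
    (h2 : 4 * α * H ^ 2 * (4 * D + 5 * H ^ 2) = 0)
    (h3 : 4 * α * k₁ * H ^ 4 + H ^ 2 = 0) : H = 0 := by
  by_contra hH
  have hH2 : H ^ 2 ≠ 0 := pow_ne_zero 2 hH
  have hk : 4 * α * k₁ * H ^ 2 = -1 := mul_left_cancel₀ hH2 (by linear_combination h3)
  have hD : D = 0 := by linear_combination -h1 + 2 * (D + H ^ 2) * hk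
  have h4α : 4 * α * H ^ 2 ≠ 0 := mul_ne_zero (mul_ne_zero four_ne_zero hα) hH2
  have h5 : 4 * D + 5 * H ^ 2 = 0 := (mul_eq_zero.mp h2).resolve_left h4α
  exact hH2 (by linarith)
end

section
/- Fix λ ∈ ℝ with λ² < 16/3 and set c = −√3·λ/4. If x : [0, ∞) → ℝ is differentiable and satisfies x'(t) = (x(t)² − 1)(√3·λ + 4x(t)) for all t ≥ 0 with x(0) ∈ (−1, 1), then x(t) ∈ (−1, 1) for all t ≥ 0 and x(t) → c as t → ∞; i.e., the scaling solution C is the late-time attractor of the model for −4/√3 < λ < 4/√3. -/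
open Filter

/-- A solution of the linear equation `y' = a(t) y` on `[0, ∞)` is given by the exponential of the
integral of its coefficient. -/
lemma eq_mul_exp_integral_of_hasDerivAt {a y : ℝ → ℝ} (ha : Continuous a)
    (hy : ∀ t : ℝ, 0 ≤ t → HasDerivAt y (a t * y t) t) {t : ℝ} (ht : 0 ≤ t) :
    y t = y 0 * Real.exp (∫ s in (0 : ℝ)..t, a s) := by
  have hd : ∀ s : ℝ, 0 ≤ s →
      HasDerivAt (fun s => y s * Real.exp (-∫ r in (0 : ℝ)..s, a r)) 0 s := by
    intro s hs
    have hA : HasDerivAt (fun s => ∫ r in (0 : ℝ)..s, a r) (a s) s :=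
      intervalIntegral.integral_hasDerivAt_right (ha.intervalIntegrable _ _)
        (ha.stronglyMeasurableAtFilter _ _) ha.continuousAt
    refine ((hy s hs).mul hA.neg.exp).congr_deriv ?_
    simp only [Pi.neg_apply]
    ring
  have h := constant_of_has_deriv_right_zero
    (fun s hs => (hd s hs.1).continuousAt.continuousWithinAt)
    (fun s hs => (hd s hs.1).hasDerivWithinAt) t ⟨ht, le_rfl⟩
  simp only [intervalIntegral.integral_same, neg_zero, Real.exp_zero, mul_one] at h
  rw [← h, mul_assoc, ← Real.exp_add, neg_add_cancel, Real.exp_zero, mul_one]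

/-- For `λ² < 16/3`, every solution of `x' = (x² − 1)(√3·λ + 4x)` on `[0, ∞)` starting in
`(−1, 1)` stays in `(−1, 1)` and converges to the scaling equilibrium `c = −√3·λ/4`
as `t → ∞`: the scaling solution `C` is the late-time attractor of the model. -/
theorem scaling_solution_late_time_attractor (lam : ℝ) (hlam : lam ^ 2 < 16 / 3)
    (c : ℝ) (hc : c = -Real.sqrt 3 * lam / 4)
    (x : ℝ → ℝ)
    (hode : ∀ t : ℝ, 0 ≤ t →
      HasDerivAt x ((x t ^ 2 - 1) * (Real.sqrt 3 * lam + 4 * x t)) t)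
    (hx0 : x 0 ∈ Set.Ioo (-1 : ℝ) 1) :
    (∀ t : ℝ, 0 ≤ t → x t ∈ Set.Ioo (-1 : ℝ) 1) ∧
    Tendsto x atTop (nhds c) := by
  have hlin : Real.sqrt 3 * lam = -(4 * c) := by rw [hc]; ring
  have hc1 : c ^ 2 < 1 := by
    have h3 : Real.sqrt 3 ^ 2 = 3 := Real.sq_sqrt (by norm_num)
    have : c ^ 2 = 3 * lam ^ 2 / 16 := by
      rw [hc]; linear_combination lam ^ 2 / 16 * h3
    linarith
  rw [hlin] at hode
  -- Freezing `x` at negative times makes the coefficients continuous on all of `ℝ`.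
  let X : ℝ → ℝ := fun t => x (max t 0)
  have hX : Continuous X := continuous_iff_continuousAt.2 fun t =>
    ContinuousAt.comp (f := fun t : ℝ => max t 0) (hode _ (le_max_right t 0)).continuousAt
      (by fun_prop)
  have hXx : ∀ t : ℝ, 0 ≤ t → X t = x t := fun t ht => by simp only [X, max_eq_left ht]
  have hmem : ∀ t : ℝ, 0 ≤ t → x t ∈ Set.Ioo (-1 : ℝ) 1 := by
    intro t ht
    have hupper := eq_mul_exp_integral_of_hasDerivAt
      (a := fun s => 4 * (1 + X s) * (X s - c)) (y := fun s => 1 - x s) (by fun_prop)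
      (fun s hs => ((hode s hs).const_sub 1).congr_deriv (by simp only [hXx s hs]; ring)) ht
    have hlower := eq_mul_exp_integral_of_hasDerivAt
      (a := fun s => 4 * (X s - 1) * (X s - c)) (y := fun s => 1 + x s) (by fun_prop)
      (fun s hs => ((hode s hs).const_add 1).congr_deriv (by simp only [hXx s hs]; ring)) ht
    have h₁ : 0 < 1 - x t := hupper ▸ mul_pos (by linarith [hx0.2]) (Real.exp_pos _)
    have h₂ : 0 < 1 + x t := hlower ▸ mul_pos (by linarith [hx0.1]) (Real.exp_pos _)
    exact ⟨by linarith, by linarith⟩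
  refine ⟨hmem, ?_⟩
  have hsol : ∀ t : ℝ, 0 ≤ t →
      x t - c = (x 0 - c) * Real.exp (∫ s in (0 : ℝ)..t, 4 * (X s ^ 2 - 1)) := fun t ht =>
    eq_mul_exp_integral_of_hasDerivAt
      (a := fun s => 4 * (X s ^ 2 - 1)) (y := fun s => x s - c) (by fun_prop)
      (fun s hs => ((hode s hs).sub_const c).congr_deriv (by simp only [hXx s hs]; ring)) ht
  obtain ⟨M, hM1, hcM, h0M⟩ : ∃ M < 1, c ^ 2 ≤ M ∧ x 0 ^ 2 ≤ M :=
    ⟨max (c ^ 2) (x 0 ^ 2), max_lt hc1 (by nlinarith [hx0.1, hx0.2]), le_max_left _ _,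
      le_max_right _ _⟩
  -- The solution stays between `c` and `x 0`, hence uniformly away from `±1`.
  have hsq : ∀ t : ℝ, 0 ≤ t → x t ^ 2 ≤ M := by
    intro t ht
    have hle : Real.exp (∫ s in (0 : ℝ)..t, 4 * (X s ^ 2 - 1)) ≤ 1 := by
      refine Real.exp_le_one_iff.2 ?_
      have h := intervalIntegral.integral_mono_on (μ := MeasureTheory.volume)
        (g := fun _ => (0 : ℝ)) ht
        (Continuous.intervalIntegrable (by fun_prop) _ _) intervalIntegrable_const
        (fun s hs => show 4 * (X s ^ 2 - 1) ≤ 0 by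
          rw [hXx s hs.1]; nlinarith [(hmem s hs.1).1, (hmem s hs.1).2])
      simpa using h
    have hconv := (Even.convexOn_pow (𝕜 := ℝ) (n := 2) even_two).2 (Set.mem_univ (x 0))
      (Set.mem_univ c) (Real.exp_pos _).le (sub_nonneg.2 hle) (add_sub_cancel _ _)
    simp only [smul_eq_mul] at hconv
    have hx : x t = Real.exp (∫ s in (0 : ℝ)..t, 4 * (X s ^ 2 - 1)) * x 0 +
        (1 - Real.exp (∫ s in (0 : ℝ)..t, 4 * (X s ^ 2 - 1))) * c := by
      linear_combination hsol t ht
    rw [hx]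
    refine hconv.trans ?_
    nlinarith [mul_le_mul_of_nonneg_left h0M
      (Real.exp_pos (∫ s in (0 : ℝ)..t, 4 * (X s ^ 2 - 1))).le,
      mul_le_mul_of_nonneg_left hcM (sub_nonneg.2 hle)]
  have hdecay : ∀ t : ℝ, 0 ≤ t → ‖x t - c‖ ≤ |x 0 - c| * Real.exp (-(t * (4 * (1 - M)))) := by
    intro t ht
    rw [hsol t ht, Real.norm_eq_abs, abs_mul, Real.abs_exp]
    gcongr
    have h := intervalIntegral.integral_mono_on (μ := MeasureTheory.volume)
      (g := fun _ => 4 * (M - 1)) ht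
      (Continuous.intervalIntegrable (by fun_prop) _ _) intervalIntegrable_const
      (fun s hs => show 4 * (X s ^ 2 - 1) ≤ 4 * (M - 1) by
        rw [hXx s hs.1]; linarith [hsq s hs.1])
    rw [intervalIntegral.integral_const, smul_eq_mul] at h
    linarith
  have hlim : Tendsto (fun t : ℝ => |x 0 - c| * Real.exp (-(t * (4 * (1 - M))))) atTop
      (nhds 0) := by
    simpa using (Real.tendsto_exp_neg_atTop_nhds_zero.comp
      (tendsto_id.atTop_mul_const (show 0 < 4 * (1 - M) by linarith))).const_mul |x 0 - c|
  exact tendsto_sub_nhds_zero_iff.1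
    (squeeze_zero_norm' ((eventually_ge_atTop 0).mono hdecay) hlim)
end

section
/- Let λ ∈ ℝ with 0 < |λ| < 4/√3. The set of points (x₁, x₄) ∈ [−1, 1] × [−1, 1] at which f₁(x₁, x₄) = 0 and f₂(x₁, x₄) = 0 simultaneously is exactly the eight points {(1,1), (1,−1), (−1,1), (−1,−1), (1, −√3·λ/4), (−1, √3·λ/4), (0,1), (0,−1)}. -/
/-- Right-hand side `f₁` of the reduced two-dimensional system for the
constant-coupling five-dimensional Einstein-Scalar-Gauss-Bonnet model. -/
noncomputable def f1 (x1 x4 : ℝ) : ℝ :=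
  2 * x1 ^ 2 * (x1 ^ 2 - 1) * x4 ^ 2 / (Real.sqrt 3 * (x1 ^ 2 - 2))

/-- Right-hand side `f₂` of the reduced two-dimensional system for the
constant-coupling five-dimensional Einstein-Scalar-Gauss-Bonnet model. -/
noncomputable def f2 (lam x1 x4 : ℝ) : ℝ :=
  (x4 ^ 2 - 1) * (3 * lam + 4 * Real.sqrt 3 * x1 * x4) / 6

/-- For `0 < |λ| < 4/√3`, the equilibrium points of the reduced two-dimensional
system in `[−1,1] × [−1,1]` are exactly the eight points
`(±1, ±1)`, `(1, −√3·λ/4)`, `(−1, √3·λ/4)`, `(0, ±1)`. -/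
theorem equilibria_constant_coupling (lam : ℝ) (h0 : 0 < |lam|)
    (h1 : |lam| < 4 / Real.sqrt 3) :
    {p : ℝ × ℝ | p.1 ∈ Set.Icc (-1 : ℝ) 1 ∧ p.2 ∈ Set.Icc (-1 : ℝ) 1 ∧
        f1 p.1 p.2 = 0 ∧ f2 lam p.1 p.2 = 0} =
      {(1, 1), (1, -1), (-1, 1), (-1, -1),
        (1, -Real.sqrt 3 * lam / 4), (-1, Real.sqrt 3 * lam / 4),
        (0, 1), (0, -1)} := by
  have hs : Real.sqrt 3 * Real.sqrt 3 = 3 := Real.mul_self_sqrt (by norm_num)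
  have hpos : 0 < Real.sqrt 3 := Real.sqrt_pos.mpr (by norm_num)
  have hlam : lam ≠ 0 := abs_pos.mp h0
  have hbound : |Real.sqrt 3 * lam / 4| ≤ 1 := by
    rw [abs_div, abs_mul, abs_of_pos hpos, abs_of_pos (by norm_num : (0 : ℝ) < 4)]
    rw [lt_div_iff₀ hpos] at h1
    linarith
  obtain ⟨hl, hu⟩ := abs_le.mp hbound
  ext ⟨x, y⟩
  simp only [Set.mem_ofPred_eq, Set.mem_insert_iff, Set.mem_singleton_iff, Prod.mk.injEq,
    Set.mem_Icc]
  constructor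
  · rintro ⟨⟨hx1, hx2⟩, -, hf1, hf2⟩
    have hden : Real.sqrt 3 * (x ^ 2 - 2) ≠ 0 :=
      mul_ne_zero hpos.ne' (by nlinarith)
    have hnum : x = 0 ∨ x = 1 ∨ x = -1 ∨ y = 0 := by
      have h : x * ((x - 1) * ((x + 1) * y)) = 0 := by
        have h' : 2 * x ^ 2 * (x ^ 2 - 1) * y ^ 2 = 0 :=
          (div_eq_zero_iff.mp hf1).resolve_right hden
        have h2 : (x ^ 2 - 1) * (x * y) ^ 2 = 0 := by linear_combination h' / 2
        rcases mul_eq_zero.mp h2 with h3 | h3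
        · linear_combination x * y * h3
        · linear_combination (x ^ 2 - 1) * (pow_eq_zero_iff two_ne_zero).mp h3
      simpa [sub_eq_zero, add_eq_zero_iff_eq_neg] using h
    have hfac : (y = 1 ∨ y = -1) ∨ 3 * lam + 4 * Real.sqrt 3 * x * y = 0 := by
      have h : (y ^ 2 - 1) * (3 * lam + 4 * Real.sqrt 3 * x * y) = 0 := by
        unfold f2 at hf2
        linarith
      exact (mul_eq_zero.mp h).imp_left fun h => by
        simpa [sub_eq_zero] using h
    rcases hnum with rfl | rfl | rfl | rfl
    · rcases hfac with (h | h) | h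
      · simp [h]
      · simp [h]
      · exact absurd (by linarith) hlam
    · rcases hfac with (h | h) | h
      · simp [h]
      · simp [h]
      · have hy : y = -Real.sqrt 3 * lam / 4 := by
          linear_combination Real.sqrt 3 / 12 * h - y / 3 * hs
        simp [hy]
    · rcases hfac with (h | h) | h
      · simp [h]
      · simp [h]
      · have hy : y = Real.sqrt 3 * lam / 4 := by
          linear_combination -Real.sqrt 3 / 12 * h - y / 3 * hs
        simp [hy]
    · rcases hfac with (h | h) | h
      · norm_num at h
      · norm_num at h
      · exact absurd (by linarith) hlam
  · rintro (⟨rfl, rfl⟩ | ⟨rfl, rfl⟩ | ⟨rfl, rfl⟩ | ⟨rfl, rfl⟩ | ⟨rfl, rfl⟩ | ⟨rfl, rfl⟩ |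
      ⟨rfl, rfl⟩ | ⟨rfl, rfl⟩)
    case inr.inr.inr.inr.inl =>
      refine ⟨by norm_num, ⟨by linarith, by linarith⟩, by simp [f1], ?_⟩
      unfold f2
      linear_combination (-lam / 6) * ((-Real.sqrt 3 * lam / 4) ^ 2 - 1) * hs
    case inr.inr.inr.inr.inr.inl =>
      refine ⟨by norm_num, ⟨by linarith, by linarith⟩, by simp [f1], ?_⟩
      unfold f2
      linear_combination (-lam / 6) * ((Real.sqrt 3 * lam / 4) ^ 2 - 1) * hs
    all_goals norm_num [f1, f2]
end

section
/- Let λ ∈ ℝ and ε, δ ∈ {−1, 1}. At the equilibrium (ε, δ) of the map F = (f₁, f₂), the Jacobian matrix is lower triangular: ∂f₁/∂x₄(ε, δ) = 0, ∂f₁/∂x₁(ε, δ) = −4ε/√3 and ∂f₂/∂x₄(ε, δ) = δλ + 4ε/√3. Consequently its eigenvalues are −4ε/√3 and δλ + 4ε/√3; in particular both eigenvalues at (1,1) are negative if and only if λ < −4/√3, and both eigenvalues at (1,−1) are negative if and only if λ > 4/√3. -/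
open Polynomial

theorem hasDerivAt_f1_fst_corner {ε δ : ℝ} (hε : ε ^ 2 = 1) (hδ : δ ^ 2 = 1) :
    HasDerivAt (fun a => f1 a δ) (-4 * ε / Real.sqrt 3) ε := by
  have hs : Real.sqrt 3 ≠ 0 := by positivity
  have hsq := (hasDerivAt_id ε).pow 2
  have hnum := ((hsq.const_mul 2).mul (hsq.sub_const 1)).mul_const (δ ^ 2)
  have hden := (hsq.sub_const 2).const_mul (Real.sqrt 3)
  have hd : Real.sqrt 3 * (ε ^ 2 - 2) ≠ 0 := by
    rw [hε]
    norm_num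
  refine (hnum.div hden hd).congr_deriv ?_
  simp only [Pi.pow_apply, id_eq, hε, hδ]
  field_simp
  norm_num [hε]
  ring

theorem f1_eq_zero_of_sq_eq_one {ε : ℝ} (hε : ε ^ 2 = 1) (b : ℝ) : f1 ε b = 0 := by
  simp [f1, hε]

theorem hasDerivAt_f2_snd_corner (lam ε : ℝ) {δ : ℝ} (hδ : δ ^ 2 = 1) :
    HasDerivAt (fun b => f2 lam ε b) (δ * lam + 4 * ε / Real.sqrt 3) δ := by
  have hs : Real.sqrt 3 ≠ 0 := by positivity
  have h3 : Real.sqrt 3 ^ 2 = 3 := Real.sq_sqrt (by norm_num)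
  have hsq := ((hasDerivAt_id δ).pow 2).sub_const 1
  have hlin := ((hasDerivAt_id δ).const_mul (4 * Real.sqrt 3 * ε)).const_add (3 * lam)
  refine ((hsq.mul hlin).div_const 6).congr_deriv ?_
  simp only [Pi.pow_apply, id_eq, hδ]
  field_simp
  norm_num
  linear_combination 8 * ε * Real.sqrt 3 ^ 2 * hδ + 8 * ε * h3

theorem charpoly_lower_triangular_fin_two {R : Type*} [CommRing R] (a c d : R) :
    Matrix.charpoly !![a, 0; c, d] = (X - C a) * (X - C d) := by
  simp [Matrix.charpoly, Matrix.det_fin_two]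

/-- At the corner equilibria `(ε, δ)` (with `ε, δ = ±1`) of the reduced system, the
Jacobian is lower triangular with `∂f₁/∂x₄ = 0`, `∂f₁/∂x₁ = −4ε/√3`,
`∂f₂/∂x₄ = δλ + 4ε/√3`; its eigenvalues are `−4ε/√3` and `δλ + 4ε/√3`, i.e. its
characteristic polynomial is `(X + 4ε/√3)(X − (δλ + 4ε/√3))`.  Both eigenvalues at
`(1,1)` are negative iff `λ < −4/√3`, and both at `(1,−1)` are negative iff `λ > 4/√3`. -/
theorem jacobian_corner_equilibria_constant_coupling (lam : ℝ)
    (ε δ : ℝ) (hε : ε = 1 ∨ ε = -1) (hδ : δ = 1 ∨ δ = -1) :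
    deriv (fun b => f1 ε b) δ = 0 ∧
    deriv (fun a => f1 a δ) ε = -4 * ε / Real.sqrt 3 ∧
    deriv (fun b => f2 lam ε b) δ = δ * lam + 4 * ε / Real.sqrt 3 ∧
    Matrix.charpoly
        (!![deriv (fun a => f1 a δ) ε, deriv (fun b => f1 ε b) δ;
            deriv (fun a => f2 lam a δ) ε, deriv (fun b => f2 lam ε b) δ]) =
      (X - C (-4 * ε / Real.sqrt 3)) * (X - C (δ * lam + 4 * ε / Real.sqrt 3)) ∧
    ((-4 * (1 : ℝ) / Real.sqrt 3 < 0 ∧ (1 : ℝ) * lam + 4 * (1 : ℝ) / Real.sqrt 3 < 0) ↔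
      lam < -4 / Real.sqrt 3) ∧
    ((-4 * (1 : ℝ) / Real.sqrt 3 < 0 ∧ (-1 : ℝ) * lam + 4 * (1 : ℝ) / Real.sqrt 3 < 0) ↔
      4 / Real.sqrt 3 < lam) := by
  have hε2 : ε ^ 2 = 1 := by rcases hε with rfl | rfl <;> norm_num
  have hδ2 : δ ^ 2 = 1 := by rcases hδ with rfl | rfl <;> norm_num
  have h₁₂ : deriv (fun b => f1 ε b) δ = 0 := by
    simp [f1_eq_zero_of_sq_eq_one hε2]
  have h₁₁ := (hasDerivAt_f1_fst_corner hε2 hδ2).deriv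
  have h₂₂ := (hasDerivAt_f2_snd_corner lam ε hδ2).deriv
  have hneg : -4 * (1 : ℝ) / Real.sqrt 3 < 0 := div_neg_of_neg_of_pos (by norm_num) (by positivity)
  refine ⟨h₁₂, h₁₁, h₂₂, ?_, ?_, ?_⟩
  · rw [h₁₁, h₁₂, h₂₂]
    exact charpoly_lower_triangular_fin_two _ _ _
  · rw [and_iff_right hneg, neg_div, one_mul, mul_one, lt_neg_iff_add_neg]
  · rw [and_iff_right hneg, mul_one, neg_one_mul, neg_add_lt_iff_lt_add, add_zero]
end

section
/- Let λ ∈ ℝ with 0 < |λ| < 4/√3 and ε ∈ {−1, 1}. At the scaling equilibrium (ε, −ε√3·λ/4) of F = (f₁, f₂), the Jacobian matrix is lower triangular with ∂f₁/∂x₄ = 0, ∂f₁/∂x₁ = −ε√3·λ²/4 and ∂f₂/∂x₄ = ε(3λ² − 16)/(8√3); hence its eigenvalues are −ε√3·λ²/4 and ε(3λ² − 16)/(8√3). For ε = 1 both eigenvalues are negative (the point P₅ is a hyperbolic attractor), and for ε = −1 both are positive (the point P₆ is a hyperbolic source). -/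
open Polynomial

theorem hasDerivAt_f1_fst {a : ℝ} (ha : a ^ 2 = 1) (b : ℝ) :
    HasDerivAt (fun x => f1 x b) (-4 * a * b ^ 2 / Real.sqrt 3) a := by
  have hne : Real.sqrt 3 ≠ 0 := (Real.sqrt_pos.mpr (by norm_num)).ne'
  have hsq : HasDerivAt (fun x : ℝ => x ^ 2) (2 * a) a := by
    simpa using hasDerivAt_pow 2 a
  have hden : Real.sqrt 3 * (a ^ 2 - 2) ≠ 0 := mul_ne_zero hne (by rw [ha]; norm_num)
  have h := (((hsq.const_mul 2).mul (hsq.sub_const 1)).mul_const (b ^ 2)).div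
    ((hsq.sub_const 2).const_mul (Real.sqrt 3)) hden
  refine h.congr_deriv ?_
  simp only [Pi.mul_apply, ha]
  field_simp
  ring

theorem hasDerivAt_f2_snd (lam a b : ℝ) :
    HasDerivAt (fun x => f2 lam a x)
      ((2 * b * (3 * lam + 4 * Real.sqrt 3 * a * b) +
        (b ^ 2 - 1) * (4 * Real.sqrt 3 * a)) / 6) b := by
  have hsq : HasDerivAt (fun x : ℝ => x ^ 2) (2 * b) b := by
    simpa using hasDerivAt_pow 2 b
  have h := ((hsq.sub_const 1).mul
    (((hasDerivAt_id b).const_mul (4 * Real.sqrt 3 * a)).const_add (3 * lam))).div_const 6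
  refine h.congr_deriv ?_
  simp

/-- For `0 < |λ| < 4/√3` and `ε = ±1`, at the scaling equilibrium `(ε, −ε√3·λ/4)` the
Jacobian is lower triangular with `∂f₁/∂x₄ = 0`, `∂f₁/∂x₁ = −ε√3·λ²/4`,
`∂f₂/∂x₄ = ε(3λ² − 16)/(8√3)`; hence its eigenvalues are `−ε√3·λ²/4` and
`ε(3λ² − 16)/(8√3)`.  For `ε = 1` both eigenvalues are negative (`P₅` is a hyperbolic
attractor), and for `ε = −1` both are positive (`P₆` is a hyperbolic source). -/
theorem jacobian_scaling_equilibria_constant_coupling (lam : ℝ)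
    (h0 : 0 < |lam|) (h1 : |lam| < 4 / Real.sqrt 3)
    (ε : ℝ) (hε : ε = 1 ∨ ε = -1) :
    deriv (fun b => f1 ε b) (-ε * Real.sqrt 3 * lam / 4) = 0 ∧
    deriv (fun a => f1 a (-ε * Real.sqrt 3 * lam / 4)) ε = -ε * Real.sqrt 3 * lam ^ 2 / 4 ∧
    deriv (fun b => f2 lam ε b) (-ε * Real.sqrt 3 * lam / 4) =
      ε * (3 * lam ^ 2 - 16) / (8 * Real.sqrt 3) ∧
    (ε = 1 →
      -ε * Real.sqrt 3 * lam ^ 2 / 4 < 0 ∧ ε * (3 * lam ^ 2 - 16) / (8 * Real.sqrt 3) < 0) ∧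
    (ε = -1 →
      0 < -ε * Real.sqrt 3 * lam ^ 2 / 4 ∧ 0 < ε * (3 * lam ^ 2 - 16) / (8 * Real.sqrt 3)) := by
  have hs : Real.sqrt 3 ^ 2 = 3 := Real.sq_sqrt (by norm_num)
  have hpos : 0 < Real.sqrt 3 := Real.sqrt_pos.mpr (by norm_num)
  have hsq : ε ^ 2 = 1 := by rcases hε with rfl | rfl <;> norm_num
  have hlam : 0 < lam ^ 2 := by
    rw [← sq_abs]
    positivity
  have hlt : 3 * lam ^ 2 - 16 < 0 := by
    rw [lt_div_iff₀ hpos] at h1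
    have h := pow_lt_pow_left₀ h1 (by positivity) two_ne_zero
    rw [mul_pow, sq_abs, hs] at h
    linarith
  refine ⟨?_, ?_, ?_, ?_, ?_⟩
  · simp [f1, hsq]
  · rw [(hasDerivAt_f1_fst hsq _).deriv]
    field_simp
    linear_combination -ε * lam ^ 2 * hsq
  · rw [(hasDerivAt_f2_snd lam ε _).deriv]
    field_simp
    linear_combination 24 * ε * lam ^ 2 * Real.sqrt 3 ^ 4 * hsq +
      ε * (24 * lam ^ 2 * (Real.sqrt 3 ^ 2 + 1) - 128) * hs
  · rintro rfl
    refine ⟨?_, div_neg_of_neg_of_pos (by linarith) (by positivity)⟩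
    have : 0 < Real.sqrt 3 * lam ^ 2 := by positivity
    linarith
  · rintro rfl
    refine ⟨?_, div_pos (by linarith) (by positivity)⟩
    have : 0 < Real.sqrt 3 * lam ^ 2 := by positivity
    linarith
end

section
/- Let λ ∈ ℝ and δ ∈ {−1, 1}. At the equilibrium (0, δ) of F = (f₁, f₂), the first row of the Jacobian matrix vanishes: ∂f₁/∂x₁(0, δ) = 0 and ∂f₁/∂x₄(0, δ) = 0, while ∂f₂/∂x₄(0, δ) = δλ. Consequently the eigenvalues of the Jacobian at (0, δ) are 0 and δλ, so the points M₁ = (0,1) and M₂ = (0,−1) are non-hyperbolic equilibria. -/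
open Polynomial

theorem hasDerivAt_f1_fst_zero (x4 : ℝ) : HasDerivAt (fun a => f1 a x4) 0 0 := by
  have hsq := hasDerivAt_pow 2 (0 : ℝ)
  have hnum := ((hsq.const_mul 2).fun_mul (hsq.sub_const 1)).mul_const (x4 ^ 2)
  have hden := (hsq.sub_const 2).const_mul √3
  exact (hnum.fun_div hden (by simp)).congr_deriv (by simp)

theorem hasDerivAt_f2_snd_zero (lam x4 : ℝ) :
    HasDerivAt (fun b => f2 lam 0 b) (x4 * lam) x4 := by
  have h := (((hasDerivAt_pow 2 x4).sub_const 1).mul_const (3 * lam)).div_const 6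
  have hf : (fun b => f2 lam 0 b) = fun b => (b ^ 2 - 1) * (3 * lam) / 6 := by
    funext b
    simp [f2]
  rw [hf]
  exact h.congr_deriv (by push_cast; ring)

/-- At the equilibria `(0, δ)` (with `δ = ±1`) of the reduced system, the first row of
the Jacobian vanishes, `∂f₂/∂x₄(0, δ) = δλ`, and consequently the eigenvalues of the
Jacobian are `0` and `δλ` (its characteristic polynomial is `X(X − δλ)`): the points
`M₁ = (0,1)` and `M₂ = (0,−1)` are non-hyperbolic equilibria. -/
theorem jacobian_M_equilibria_constant_coupling (lam : ℝ)
    (δ : ℝ) (hδ : δ = 1 ∨ δ = -1) :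
    deriv (fun a => f1 a δ) 0 = 0 ∧
    deriv (fun b => f1 0 b) δ = 0 ∧
    deriv (fun b => f2 lam 0 b) δ = δ * lam ∧
    Matrix.charpoly
        (!![deriv (fun a => f1 a δ) 0, deriv (fun b => f1 0 b) δ;
            deriv (fun a => f2 lam a δ) 0, deriv (fun b => f2 lam 0 b) δ]) =
      X * (X - C (δ * lam)) := by
  have h11 := (hasDerivAt_f1_fst_zero δ).deriv
  have h12 : deriv (fun b => f1 0 b) δ = 0 := by simp [f1]
  have h22 := (hasDerivAt_f2_snd_zero lam δ).deriv
  refine ⟨h11, h12, h22, ?_⟩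
  rw [h11, h12, h22, Matrix.charpoly, Matrix.det_fin_two]
  simp
end

section
/- Fix λ ∈ ℝ with 0 < λ² < 16/3. If (x₁, x₄) : [0, ∞) → ℝ² is differentiable, solves x₁'(t) = f₁(x₁(t), x₄(t)), x₄'(t) = f₂(x₁(t), x₄(t)) for all t ≥ 0, and satisfies x₁(0) = 1 and x₄(0) ∈ (−1, 1), then x₁(t) = 1 for all t ≥ 0 and x₄(t) → −√3·λ/4 as t → ∞; i.e., the line {x₁ = 1} is invariant and on it the scaling solution P₅ attracts all orbits starting with x₄ ∈ (−1, 1). -/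
open Filter

/-- On the band `|x₁ - 1| ≤ 1/10` the vector field `f₁` points towards `x₁ = 1`. -/
lemma sub_one_mul_f1_nonpos {x : ℝ} (y : ℝ) (hx : (x - 1) ^ 2 ≤ 1 / 100) :
    (x - 1) * f1 x y ≤ 0 := by
  have hl : 9 / 10 ≤ x := by nlinarith
  have hu : x ≤ 11 / 10 := by nlinarith
  have hden : Real.sqrt 3 * (x ^ 2 - 2) < 0 :=
    mul_neg_of_pos_of_neg (by positivity) (by nlinarith)
  have hnum : 0 ≤ 2 * x ^ 2 * (x + 1) * y ^ 2 * (x - 1) ^ 2 := by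
    have : 0 ≤ x + 1 := by linarith
    positivity
  have h : (x - 1) * f1 x y =
      2 * x ^ 2 * (x + 1) * y ^ 2 * (x - 1) ^ 2 / (Real.sqrt 3 * (x ^ 2 - 2)) := by
    rw [f1, mul_div_assoc']
    ring
  rw [h]
  exact div_nonpos_of_nonneg_of_nonpos hnum hden.le

/-- The line `x₁ = 1` is forward invariant for `x₁' = f₁(x₁, y)`, for any function `y`. -/
lemma eq_one_of_hasDerivAt_f1 {x y : ℝ → ℝ}
    (hx : ∀ t : ℝ, 0 ≤ t → HasDerivAt x (f1 (x t) (y t)) t) (hx0 : x 0 = 1)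
    {T : ℝ} (hT : 0 ≤ T) : x T = 1 := by
  have hV : ∀ t : ℝ, 0 ≤ t →
      HasDerivAt (fun s => (x s - 1) ^ 2) (2 * ((x t - 1) * f1 (x t) (y t))) t := by
    intro t ht
    refine (((hx t ht).sub_const 1).fun_pow 2).congr_deriv ?_
    push_cast
    ring
  have key : ∀ ε : ℝ, 0 < ε → ε ≤ 1 / 100 → (x T - 1) ^ 2 ≤ ε := by
    intro ε hε hε'
    set δ := ε / (1 + T) with hδ
    have hδ0 : 0 < δ := by positivity
    have hδT : δ * (1 + T) = ε := by rw [hδ]; field_simp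
    have hB : ∀ t : ℝ, HasDerivAt (fun s => δ * (1 + s)) δ t := fun t => by
      simpa using ((hasDerivAt_id t).const_add 1).const_mul δ
    have := image_le_of_deriv_right_lt_deriv_boundary
      (f := fun s => (x s - 1) ^ 2) (a := 0) (b := T) (B := fun s => δ * (1 + s))
      (B' := fun _ => δ)
      (fun t ht => (hV t ht.1).continuousAt.continuousWithinAt)
      (fun t ht => (hV t ht.1).hasDerivWithinAt)
      (by simp [hx0, hδ0.le]) hB
      (fun t ht h => by
        have hle : (x t - 1) ^ 2 ≤ 1 / 100 := by
          rw [h]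
          nlinarith [ht.2]
        linarith [sub_one_mul_f1_nonpos (y t) hle])
      (Set.right_mem_Icc.2 hT)
    simpa [hδT] using this
  have hz : (x T - 1) ^ 2 ≤ 0 := by
    refine le_of_forall_pos_le_add fun ε hε => ?_
    have := key (min ε (1 / 100)) (by positivity) (min_le_right _ _)
    linarith [min_le_left ε (1 / 100)]
  exact sub_eq_zero.1 (pow_eq_zero_iff two_ne_zero |>.1 (le_antisymm hz (sq_nonneg _)))

/-- A solution of the cubic equation `y' = c (y² - 1) (y - a)` with `c > 0` and `|a| < R < 1`
that starts with `y(0) ≤ R` stays below `R`. -/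
lemma le_of_hasDerivAt_cubic {a c R : ℝ} {y : ℝ → ℝ} (hc : 0 < c) (haR : |a| < R) (hR : R < 1)
    (hy : ∀ t : ℝ, 0 ≤ t → HasDerivAt y (c * (y t ^ 2 - 1) * (y t - a)) t)
    (hy0 : y 0 ≤ R) {T : ℝ} (hT : 0 ≤ T) : y T ≤ R := by
  have hR0 : 0 < R := (abs_nonneg a).trans_lt haR
  refine image_le_of_deriv_right_lt_deriv_boundary
    (f := y) (a := 0) (b := T) (B := fun _ => R) (B' := fun _ => 0)
    (fun t ht => (hy t ht.1).continuousAt.continuousWithinAt)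
    (fun t ht => (hy t ht.1).hasDerivWithinAt)
    hy0 (fun t => hasDerivAt_const t R) (fun t _ h => ?_) (Set.right_mem_Icc.2 hT)
  rw [h]
  have h1 : R ^ 2 - 1 < 0 := by nlinarith
  have h2 : 0 < R - a := by linarith [le_abs_self a]
  exact mul_neg_of_neg_of_pos (mul_neg_of_pos_of_neg hc h1) h2

/-- The equilibrium `a` of `y' = c (y² - 1) (y - a)`, `c > 0`, `|a| < 1`, attracts every solution
starting in `(-1, 1)`. -/
lemma tendsto_of_hasDerivAt_cubic {a c : ℝ} {y : ℝ → ℝ} (hc : 0 < c) (ha : |a| < 1)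
    (hy : ∀ t : ℝ, 0 ≤ t → HasDerivAt y (c * (y t ^ 2 - 1) * (y t - a)) t)
    (hy0 : |y 0| < 1) : Tendsto y atTop (nhds a) := by
  obtain ⟨R, hmax, hR⟩ := exists_between (max_lt ha hy0)
  obtain ⟨haR, hyR⟩ := max_lt_iff.1 hmax
  have hup : ∀ t : ℝ, 0 ≤ t → y t ≤ R := fun t ht =>
    le_of_hasDerivAt_cubic hc haR hR hy ((le_abs_self _).trans hyR.le) ht
  have hlow : ∀ t : ℝ, 0 ≤ t → -y t ≤ R := fun t ht =>
    le_of_hasDerivAt_cubic (a := -a) (y := fun s => -y s) hc (by rwa [abs_neg]) hR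
      (fun s hs => (hy s hs).fun_neg.congr_deriv (by ring)) ((neg_le_abs _).trans hyR.le) ht
  set k := 2 * c * (1 - R ^ 2) with hk
  have hR0 : 0 < R := (abs_nonneg a).trans_lt haR
  have hk0 : 0 < k := mul_pos (by positivity) (by nlinarith)
  have hW : ∀ t : ℝ, 0 ≤ t → HasDerivAt (fun s => (y s - a) ^ 2 * Real.exp (k * s))
      ((2 * c * (y t ^ 2 - 1) + k) * (y t - a) ^ 2 * Real.exp (k * t)) t := by
    intro t ht
    have he : HasDerivAt (fun s => Real.exp (k * s)) (Real.exp (k * t) * k) t := by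
      simpa using ((hasDerivAt_id t).const_mul k).exp
    refine ((((hy t ht).sub_const a).fun_pow 2).fun_mul he).congr_deriv ?_
    push_cast
    ring
  have hanti : AntitoneOn (fun s => (y s - a) ^ 2 * Real.exp (k * s)) (Set.Ici 0) := by
    refine antitoneOn_of_hasDerivWithinAt_nonpos (convex_Ici 0)
      (fun t ht => (hW t ht).continuousAt.continuousWithinAt)
      (fun t ht => (hW t (interior_subset ht)).hasDerivWithinAt) (fun t ht => ?_)
    have ht0 : (0 : ℝ) ≤ t := interior_subset ht
    have hsq : y t ^ 2 ≤ R ^ 2 := by nlinarith [hup t ht0, hlow t ht0]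
    have hneg : 2 * c * (y t ^ 2 - 1) + k ≤ 0 := by
      rw [hk]
      nlinarith
    exact mul_nonpos_of_nonpos_of_nonneg
      (mul_nonpos_of_nonpos_of_nonneg hneg (sq_nonneg _)) (Real.exp_pos _).le
  have hbound : ∀ t : ℝ, 0 ≤ t → (y t - a) ^ 2 ≤ (y 0 - a) ^ 2 * Real.exp (-(k * t)) := by
    intro t ht
    have h : (y t - a) ^ 2 * Real.exp (k * t) ≤ (y 0 - a) ^ 2 := by
      simpa using hanti Set.self_mem_Ici ht ht
    rw [Real.exp_neg, ← div_eq_mul_inv]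
    exact (le_div_iff₀ (Real.exp_pos _)).2 h
  have hlim : Tendsto (fun t => (y 0 - a) ^ 2 * Real.exp (-(k * t))) atTop (nhds 0) := by
    simpa using (Real.tendsto_exp_neg_atTop_nhds_zero.comp
      (tendsto_id.const_mul_atTop hk0)).const_mul ((y 0 - a) ^ 2)
  have hsq : Tendsto (fun t => (y t - a) ^ 2) atTop (nhds 0) :=
    squeeze_zero' (Eventually.of_forall fun t => sq_nonneg _)
      ((eventually_ge_atTop 0).mono hbound) hlim
  have habs : Tendsto (fun t => |y t - a|) atTop (nhds 0) := by
    simpa [Real.sqrt_sq_eq_abs] using hsq.sqrt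
  exact tendsto_sub_nhds_zero_iff.1 ((tendsto_zero_iff_abs_tendsto_zero _).2 habs)

/-- For `0 < λ² < 16/3`, every solution of the reduced two-dimensional system starting
at `x₁(0) = 1`, `x₄(0) ∈ (−1, 1)` stays on the invariant line `{x₁ = 1}` and converges
to the scaling equilibrium `P₅ = (1, −√3·λ/4)` as `t → ∞`. -/
theorem scaling_attractor_on_invariant_line (lam : ℝ)
    (h0 : 0 < lam ^ 2) (h1 : lam ^ 2 < 16 / 3)
    (x1 x4 : ℝ → ℝ)
    (hode1 : ∀ t : ℝ, 0 ≤ t → HasDerivAt x1 (f1 (x1 t) (x4 t)) t)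
    (hode4 : ∀ t : ℝ, 0 ≤ t → HasDerivAt x4 (f2 lam (x1 t) (x4 t)) t)
    (hinit1 : x1 0 = 1) (hinit4 : x4 0 ∈ Set.Ioo (-1 : ℝ) 1) :
    (∀ t : ℝ, 0 ≤ t → x1 t = 1) ∧
    Tendsto x4 atTop (nhds (-Real.sqrt 3 * lam / 4)) := by
  have hline : ∀ t : ℝ, 0 ≤ t → x1 t = 1 := fun t ht =>
    eq_one_of_hasDerivAt_f1 hode1 hinit1 ht
  refine ⟨hline, ?_⟩
  have h3 : Real.sqrt 3 ^ 2 = 3 := Real.sq_sqrt (by norm_num)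
  refine tendsto_of_hasDerivAt_cubic (c := 2 * Real.sqrt 3 / 3) (by positivity) ?_
    (fun t ht => (hode4 t ht).congr_deriv ?_) (abs_lt.2 hinit4)
  · rw [← sq_lt_one_iff_abs_lt_one]
    nlinarith
  · rw [hline t ht, f2]
    linear_combination (-(lam * (x4 t ^ 2 - 1)) / 6) * h3
end

section
/- Let λ ∈ ℝ and fix c ∈ ℝ. Then the function x₁ ↦ q(x₁, 1, c), defined for x₁ ≠ 0, tends to (c⁴ − 12√2·c² + 16)/(4c⁴ − 8√2·c² + 16) as x₁ → 0; i.e., the limiting deceleration parameter along the family L₁ = (0, 1, c) equals (c⁴ − 12√2·c² + 16)/(4c⁴ − 8√2·c² + 16). -/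
open Filter

/-- Deceleration parameter of the reduced three-dimensional system for the
linear-coupling five-dimensional Einstein-Scalar-Gauss-Bonnet model. -/
noncomputable def decelLin (lam x1 x4 x5 : ℝ) : ℝ :=
  -(8 * x1 ^ 3 +
      x1 * (32 * x4 ^ 2 - 12 * Real.sqrt 2 * x4 * x5 ^ 2 + x5 ^ 4 - 16) +
      4 * Real.sqrt 6 * lam * (x4 ^ 2 - 1) * x5 ^ 2) /
    (4 * x1 * (2 * x1 ^ 2 + 2 * Real.sqrt 2 * x4 * x5 ^ 2 - x5 ^ 4 - 4))

/-- Along `x4 = 1` the common factor `x1` cancels from the deceleration parameter. -/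
theorem decelLin_one (lam c : ℝ) {x : ℝ} (hx : x ≠ 0) :
    decelLin lam x 1 c =
      -(8 * x ^ 2 + (c ^ 4 - 12 * Real.sqrt 2 * c ^ 2 + 16)) /
        (4 * (2 * x ^ 2 + 2 * Real.sqrt 2 * c ^ 2 - c ^ 4 - 4)) := by
  rw [decelLin, ← mul_div_mul_left _ (4 * (2 * x ^ 2 + 2 * Real.sqrt 2 * c ^ 2 - c ^ 4 - 4)) hx]
  congr 1 <;> ring

theorem limit_denominator_neg (c : ℝ) : 2 * Real.sqrt 2 * c ^ 2 - c ^ 4 - 4 < 0 := by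
  nlinarith [sq_nonneg (c ^ 2 - Real.sqrt 2), Real.sq_sqrt (zero_le_two : (0 : ℝ) ≤ 2)]

/-- The limiting deceleration parameter along the family `L₁ = (0, 1, c)`:
`x₁ ↦ q(x₁, 1, c)` tends to `(c⁴ − 12√2·c² + 16)/(4c⁴ − 8√2·c² + 16)` as
`x₁ → 0` through nonzero values. -/
theorem L1_limit_deceleration (lam : ℝ) (c : ℝ) :
    Tendsto (fun x1 => decelLin lam x1 1 c) (nhdsWithin 0 {x : ℝ | x ≠ 0})
      (nhds ((c ^ 4 - 12 * Real.sqrt 2 * c ^ 2 + 16) /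
        (4 * c ^ 4 - 8 * Real.sqrt 2 * c ^ 2 + 16))) := by
  have hden := limit_denominator_neg c
  have hcont : ContinuousAt (fun x : ℝ =>
      -(8 * x ^ 2 + (c ^ 4 - 12 * Real.sqrt 2 * c ^ 2 + 16)) /
        (4 * (2 * x ^ 2 + 2 * Real.sqrt 2 * c ^ 2 - c ^ 4 - 4))) 0 := by
    refine ContinuousAt.div (by fun_prop) (by fun_prop) ?_
    apply ne_of_lt
    linarith
  have hval : -(8 * (0 : ℝ) ^ 2 + (c ^ 4 - 12 * Real.sqrt 2 * c ^ 2 + 16)) /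
        (4 * (2 * (0 : ℝ) ^ 2 + 2 * Real.sqrt 2 * c ^ 2 - c ^ 4 - 4)) =
      (c ^ 4 - 12 * Real.sqrt 2 * c ^ 2 + 16) /
        (4 * c ^ 4 - 8 * Real.sqrt 2 * c ^ 2 + 16) := by
    rw [← neg_div_neg_eq]
    congr 1 <;> ring
  rw [← hval]
  refine (hcont.tendsto.mono_left nhdsWithin_le_nhds).congr' ?_
  filter_upwards [self_mem_nhdsWithin] with x hx
  exact (decelLin_one lam c hx).symm
end

section
/- For every real x, 4x⁴ − 8√2·x² + 16 > 0; and for every x with 0 ≤ x ≤ 2^{−1/4}, 0 ≤ (x⁴ − 12√2·x² + 16)/(4x⁴ − 8√2·x² + 16) ≤ 1. Hence, on its existence range 0 ≤ x₅ ≤ 2^{−1/4}, the family L₁ cannot describe an accelerated solution, since its limiting deceleration parameter lies in [0, 1]. -/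
/-- For every real `x`, `4x⁴ − 8√2·x² + 16 > 0`, and for `0 ≤ x ≤ 2^{-1/4}` the limiting
deceleration parameter `(x⁴ − 12√2·x² + 16)/(4x⁴ − 8√2·x² + 16)` of the family `L₁`
lies in `[0, 1]`: on its existence range, `L₁` cannot describe an accelerated solution. -/
theorem L1_no_acceleration :
    (∀ x : ℝ, 0 < 4 * x ^ 4 - 8 * Real.sqrt 2 * x ^ 2 + 16) ∧
    (∀ x : ℝ, 0 ≤ x → x ≤ (2 : ℝ) ^ (-(1 / 4) : ℝ) →
      0 ≤ (x ^ 4 - 12 * Real.sqrt 2 * x ^ 2 + 16) /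
            (4 * x ^ 4 - 8 * Real.sqrt 2 * x ^ 2 + 16) ∧
      (x ^ 4 - 12 * Real.sqrt 2 * x ^ 2 + 16) /
            (4 * x ^ 4 - 8 * Real.sqrt 2 * x ^ 2 + 16) ≤ 1) := by
  have hs : √(2 : ℝ) ^ 2 = 2 := Real.sq_sqrt (by norm_num)
  have hpos (x : ℝ) : 0 < 4 * x ^ 4 - 8 * √2 * x ^ 2 + 16 := by
    nlinarith [sq_nonneg (x ^ 2 - √2)]
  refine ⟨hpos, fun x hx hle => ⟨div_nonneg ?_ (hpos x).le, (div_le_one (hpos x)).mpr ?_⟩⟩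
  · have hx4 : x ^ 4 ≤ 1 / 2 := by
      calc x ^ 4 ≤ ((2 : ℝ) ^ (-(1 / 4) : ℝ)) ^ 4 := by gcongr
        _ = 1 / 2 := by
          rw [← Real.rpow_mul_natCast (by norm_num)]
          norm_num [Real.rpow_neg_one]
    have hsx : √2 * x ^ 2 ≤ 1 := by
      refine (sq_le_one_iff₀ (by positivity)).mp ?_
      rw [mul_pow, hs]
      linarith
    nlinarith [pow_nonneg hx 4]
  · have : 0 ≤ √2 * x ^ 2 := by positivity
    nlinarith [pow_nonneg hx 4]
end
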